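/- For all y, z ∈ ℂ³, the 4×4 complex matrices M(y), M(z) satisfy conj(M(y))·M(z) + conj(M(z))·M(y) = −2·Re⟨y,z⟩·I, where ⟨y,z⟩ = Σ_{i=1}^{3} y_i·conj(z_i), conj(M) denotes entrywise complex conjugation, and I is the 4×4 identity matrix. -/

import Mathlib

open Matrix

/-- The skew-symmetric matrix `M(z)`, `z ∈ ℂ³`, representing Clifford multiplication. -/
noncomputable def Mz (z : Fin 3 → ℂ) : Matrix (Fin 4) (Fin 4) ℂ :=
  !![0, -z 2, -z 1, -z 0;
     z 2, 0, -(starRingEnd ℂ) (z 0), (starRingEnd ℂ) (z 1);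
     z 1, (starRingEnd ℂ) (z 0), 0, -(starRingEnd ℂ) (z 2);
     z 0, -(starRingEnd ℂ) (z 1), (starRingEnd ℂ) (z 2), 0]

/-- The Clifford identity `conj(M(y))·M(z) + conj(M(z))·M(y) = −2 Re⟨y,z⟩·I`. -/
theorem Mz_clifford (y z : Fin 3 → ℂ) :
    (Mz y).map (starRingEnd ℂ) * Mz z + (Mz z).map (starRingEnd ℂ) * Mz y
      = (-2 * (∑ i, y i * (starRingEnd ℂ) (z i)).re) • (1 : Matrix (Fin 4) (Fin 4) ℂ) := by
  ext i j
  fin_cases i <;> fin_cases j <;>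
    simp [Mz, Matrix.mul_apply, Fin.sum_univ_four, Fin.sum_univ_three, Complex.ext_iff] <;>
    constructor <;> ring
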